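/- Total variation of the gradient of the discrete heat kernel on ℤ: for all c > 0 and all t ≥ 0, Σ_{k∈ℤ} |p̄_t(k+1) - p̄_t(k)| ≤ 2·p̄_t(0). -/

import Mathlib

/-- `n`-step simple random walk distribution on `ℤ`:
`q_n(ℓ) = 2^{-n}·binom(n,(n+ℓ)/2)` if `n+ℓ` is even and `|ℓ| ≤ n`, and `0` otherwise. -/
noncomputable def rwStep (n : ℕ) (l : ℤ) : ℝ :=
  if ((n : ℤ) + l) % 2 = 0 ∧ |l| ≤ (n : ℤ) then
    ((1 : ℝ) / 2) ^ n * (Nat.choose n (((n : ℤ) + l) / 2).toNat : ℝ)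
  else 0

/-- The discrete heat kernel on `ℤ` sped up by `2c`:
`p̄_t(ℓ) = e^{-2ct} Σ_{n≥0} ((2ct)^n/n!) q_n(ℓ)`. -/
noncomputable def heatKernelZ (c t : ℝ) (l : ℤ) : ℝ :=
  Real.exp (-(2 * c * t)) * ∑' n : ℕ, (2 * c * t) ^ n / (Nat.factorial n : ℝ) * rwStep n l

lemma rwStep_two_mul_sub (n k : ℕ) :
    rwStep n (2 * (k : ℤ) - n) = (1 / 2 : ℝ) ^ n * (n.choose k : ℝ) := by
  unfold rwStep
  have hk : (((n : ℤ) + (2 * (k : ℤ) - n)) / 2).toNat = k := by omega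
  rw [hk]
  split_ifs with h
  · rfl
  · have : n < k := by
      by_contra hle
      exact h ⟨by omega, by rw [abs_le]; omega⟩
    simp [Nat.choose_eq_zero_of_lt this]

lemma rwStep_eq_zero_of_lt {n : ℕ} {l : ℤ} (h : l < -n) : rwStep n l = 0 := by
  refine if_neg fun H => ?_
  have := (abs_le.1 H.2).1
  omega

lemma rwStep_eq_zero_of_odd {n : ℕ} {l : ℤ} (h : ((n : ℤ) + l) % 2 ≠ 0) : rwStep n l = 0 :=
  if_neg fun H => h H.1

lemma rwStep_succ (n : ℕ) (l : ℤ) :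
    rwStep (n + 1) l = (rwStep n (l - 1) + rwStep n (l + 1)) / 2 := by
  by_cases hl : ((n : ℤ) + 1 + l) % 2 = 0
  · obtain ⟨m, rfl⟩ : ∃ m : ℤ, l = 2 * m - (n + 1) := ⟨((n : ℤ) + 1 + l) / 2, by omega⟩
    rcases lt_trichotomy m 0 with hm | rfl | hm
    · rw [rwStep_eq_zero_of_lt (by push_cast; omega), rwStep_eq_zero_of_lt (by omega),
        rwStep_eq_zero_of_lt (by omega)]
      simp
    · have h₁ := rwStep_two_mul_sub (n + 1) 0
      have h₂ := rwStep_two_mul_sub n 0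
      rw [Nat.cast_zero] at h₁ h₂
      rw [Nat.cast_succ] at h₁
      rw [h₁, rwStep_eq_zero_of_lt (by omega),
        show (2 * 0 - ((n : ℤ) + 1) + 1) = 2 * 0 - n by ring, h₂]
      simp [pow_succ]
      ring
    · obtain ⟨k, rfl⟩ : ∃ k : ℕ, m = k + 1 := ⟨(m - 1).toNat, by omega⟩
      have h₁ := rwStep_two_mul_sub (n + 1) (k + 1)
      have h₂ := rwStep_two_mul_sub n (k + 1)
      have h₃ := rwStep_two_mul_sub n k
      push_cast at h₁ h₂
      rw [h₁, show 2 * ((k : ℤ) + 1) - (n + 1) - 1 = 2 * k - n by ring,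
        show 2 * ((k : ℤ) + 1) - (n + 1) + 1 = 2 * (k + 1) - n by ring, h₂, h₃,
        Nat.choose_succ_succ]
      push_cast
      ring
  · rw [rwStep_eq_zero_of_odd (by push_cast; omega), rwStep_eq_zero_of_odd (by omega),
      rwStep_eq_zero_of_odd (by omega)]
    simp

lemma rwStep_nonneg (n : ℕ) (l : ℤ) : 0 ≤ rwStep n l := by
  unfold rwStep
  split_ifs <;> positivity

lemma rwStep_le_one (n : ℕ) (l : ℤ) : rwStep n l ≤ 1 := by
  unfold rwStep
  split_ifs
  · have h : (n.choose (((n : ℤ) + l) / 2).toNat : ℝ) ≤ 2 ^ n := by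
      exact_mod_cast Nat.choose_le_two_pow _ _
    calc _ ≤ (1 / 2 : ℝ) ^ n * 2 ^ n := by gcongr
      _ = 1 := by rw [← mul_pow]; norm_num
  · exact zero_le_one

/-- The transition operator of the simple random walk on `ℤ`. -/
noncomputable def nbrAvg : Module.End ℝ (ℤ → ℝ) where
  toFun f l := (f (l - 1) + f (l + 1)) / 2
  map_add' f g := by ext l; simp only [Pi.add_apply]; ring
  map_smul' a f := by ext l; simp only [Pi.smul_apply, smul_eq_mul, RingHom.id_apply]; ring

lemma nbrAvg_apply (f : ℤ → ℝ) (l : ℤ) : nbrAvg f l = (f (l - 1) + f (l + 1)) / 2 := rfl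

lemma nbrAvg_pow_apply_rwStep_zero (n : ℕ) : (nbrAvg ^ n) (rwStep 0) = rwStep n := by
  induction n with
  | zero => simp
  | succ n ih =>
    rw [pow_succ', Module.End.mul_apply, ih]
    ext l
    rw [nbrAvg_apply, rwStep_succ]

/-- The unnormalised `n`-step distribution of the lazy walk, which holds with probability `1/2`. -/
noncomputable def lazyStep (n : ℕ) : ℤ → ℝ := ((1 + nbrAvg) ^ n) (rwStep 0)

lemma lazyStep_succ (n : ℕ) (l : ℤ) :
    lazyStep (n + 1) l = lazyStep n l + (lazyStep n (l - 1) + lazyStep n (l + 1)) / 2 := by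
  simp only [lazyStep, pow_succ', Module.End.mul_apply, LinearMap.add_apply, Module.End.one_apply,
    Pi.add_apply, nbrAvg_apply]

lemma lazyStep_eq_sum (n : ℕ) (l : ℤ) :
    lazyStep n l = ∑ ij ∈ Finset.HasAntidiagonal.antidiagonal n,
      (n.choose ij.1 : ℝ) * rwStep ij.2 l := by
  rw [lazyStep, (Commute.one_left nbrAvg).add_pow']
  simp [LinearMap.sum_apply, Finset.sum_apply, nbrAvg_pow_apply_rwStep_zero]

lemma rwStep_zero_eq (l : ℤ) : rwStep 0 l = if l = 0 then 1 else 0 := by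
  by_cases h : l = 0 <;> simp [rwStep, h]

lemma lazyStep_neg (n : ℕ) (l : ℤ) : lazyStep n (-l) = lazyStep n l := by
  induction n generalizing l with
  | zero => simp [lazyStep, rwStep_zero_eq]
  | succ n ih =>
    rw [lazyStep_succ, lazyStep_succ, ih, show -l - 1 = -(l + 1) by ring,
      show -l + 1 = -(l - 1) by ring, ih, ih]
    ring

lemma lazyStep_nonneg (n : ℕ) (l : ℤ) : 0 ≤ lazyStep n l := by
  rw [lazyStep_eq_sum]
  exact Finset.sum_nonneg fun ij _ => mul_nonneg (Nat.cast_nonneg _) (rwStep_nonneg _ _)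

lemma lazyStep_antitone (n : ℕ) (k : ℕ) : lazyStep n (k + 1) ≤ lazyStep n k := by
  induction n generalizing k with
  | zero =>
    have : (k : ℤ) + 1 ≠ 0 := by omega
    simp only [lazyStep, pow_zero, Module.End.one_apply, rwStep_zero_eq, if_neg this]
    split_ifs <;> norm_num
  | succ n ih =>
    rw [lazyStep_succ, lazyStep_succ, add_sub_cancel_right]
    have h₀ := ih k
    have h₁ := ih (k + 1)
    push_cast at h₁
    rcases k with _ | k
    · have h := lazyStep_neg n 1
      norm_num at h h₀ h₁ ⊢
      linarith
    · have h₂ := ih k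
      push_cast at *
      rw [add_sub_cancel_right]
      linarith

lemma summable_norm_rwStep (b : ℝ) (l : ℤ) :
    Summable fun n : ℕ => ‖b ^ n / (n.factorial : ℝ) * rwStep n l‖ := by
  refine (Real.summable_pow_div_factorial b).norm.of_nonneg_of_le (fun _ => norm_nonneg _)
    fun n => ?_
  rw [norm_mul, Real.norm_of_nonneg (rwStep_nonneg n l)]
  exact mul_le_of_le_one_right (norm_nonneg _) (rwStep_le_one n l)

lemma sum_antidiagonal_eq_lazyStep (b : ℝ) (l : ℤ) (n : ℕ) :
    ∑ ij ∈ Finset.HasAntidiagonal.antidiagonal n, b ^ ij.1 / (ij.1.factorial : ℝ) *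
      (b ^ ij.2 / (ij.2.factorial : ℝ) * rwStep ij.2 l) =
      b ^ n / (n.factorial : ℝ) * lazyStep n l := by
  rw [lazyStep_eq_sum, Finset.mul_sum]
  refine Finset.sum_congr rfl fun ⟨i, j⟩ hij => ?_
  obtain rfl : i + j = n := Finset.HasAntidiagonal.mem_antidiagonal.1 hij
  have h : ((i + j).factorial : ℝ) = (i + j).choose i * i.factorial * j.factorial := by
    rw [Nat.choose_symm_add]
    exact_mod_cast (Nat.add_choose_mul_factorial_mul_factorial i j).symm
  have h₁ : (i.factorial : ℝ) ≠ 0 := by positivity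
  have h₂ : (j.factorial : ℝ) ≠ 0 := by positivity
  have h₃ : ((i + j).choose i : ℝ) ≠ 0 := by
    exact_mod_cast (Nat.choose_pos (Nat.le_add_right i j)).ne'
  simp only [h, pow_add]
  field_simp

lemma summable_lazyStep (b : ℝ) (l : ℤ) :
    Summable fun n : ℕ => b ^ n / (n.factorial : ℝ) * lazyStep n l := by
  have h := (summable_norm_sum_mul_antidiagonal_of_summable_norm
    (Real.summable_pow_div_factorial b).norm (summable_norm_rwStep b l)).of_norm
  simpa only [sum_antidiagonal_eq_lazyStep] using h

/-- The simple random walk at rate `2 * c` is the lazy walk at rate `4 * c`. -/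
lemma heatKernelZ_eq_lazyStep (c t : ℝ) (l : ℤ) :
    heatKernelZ c t l = Real.exp (-(2 * (2 * c * t))) *
      ∑' n : ℕ, (2 * c * t) ^ n / (n.factorial : ℝ) * lazyStep n l := by
  have h := tsum_mul_tsum_eq_tsum_sum_antidiagonal_of_summable_norm
    (Real.summable_pow_div_factorial (2 * c * t)).norm (summable_norm_rwStep (2 * c * t) l)
  simp only [sum_antidiagonal_eq_lazyStep] at h
  rw [← h, ← congrFun NormedSpace.exp_eq_tsum_div (2 * c * t), ← Real.exp_eq_exp_ℝ, ← mul_assoc,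
    ← Real.exp_add, heatKernelZ]
  congr 2
  ring

lemma heatKernelZ_neg (c t : ℝ) (l : ℤ) : heatKernelZ c t (-l) = heatKernelZ c t l := by
  simp only [heatKernelZ_eq_lazyStep, lazyStep_neg]

lemma heatKernelZ_nonneg {c t : ℝ} (h : 0 ≤ c * t) (l : ℤ) : 0 ≤ heatKernelZ c t l := by
  have hb : 0 ≤ 2 * c * t := by linarith
  exact mul_nonneg (Real.exp_pos _).le
    (tsum_nonneg fun n => mul_nonneg (by positivity) (rwStep_nonneg n l))

lemma heatKernelZ_antitone {c t : ℝ} (h : 0 ≤ c * t) (k : ℕ) :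
    heatKernelZ c t (k + 1) ≤ heatKernelZ c t k := by
  have hb : 0 ≤ 2 * c * t := by linarith
  simp only [heatKernelZ_eq_lazyStep]
  exact mul_le_mul_of_nonneg_left ((summable_lazyStep _ _).tsum_le_tsum
    (fun n => mul_le_mul_of_nonneg_left (lazyStep_antitone n k) (by positivity))
    (summable_lazyStep _ _)) (Real.exp_pos _).le

/-- A nonnegative even function on `ℤ` that decreases on `ℕ` has total variation at most twice
its value at `0`. -/
lemma summable_and_tsum_abs_sub_le_of_even {f : ℤ → ℝ} (hneg : ∀ l, f (-l) = f l)
    (h0 : ∀ l, 0 ≤ f l) (hanti : ∀ k : ℕ, f (k + 1) ≤ f k) :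
    Summable (fun k : ℤ => |f (k + 1) - f k|) ∧ ∑' k : ℤ, |f (k + 1) - f k| ≤ 2 * f 0 := by
  have hpart (n : ℕ) : ∑ i ∈ Finset.range n, |f ((i : ℤ) + 1) - f i| ≤ f 0 := by
    have heq : ∀ i ∈ Finset.range n, |f ((i : ℤ) + 1) - f i| = f (i : ℤ) - f ((i + 1 : ℕ) : ℤ) := by
      intro i _
      rw [abs_sub_comm, abs_of_nonneg (sub_nonneg.2 (hanti i))]
      push_cast
      rfl
    rw [Finset.sum_congr rfl heq, Finset.sum_range_sub' (fun i : ℕ => f (i : ℤ))]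
    simpa using h0 n
  have hrefl (n : ℕ) : |f (-((n : ℤ) + 1) + 1) - f (-((n : ℤ) + 1))| = |f ((n : ℤ) + 1) - f n| := by
    rw [hneg, show -((n : ℤ) + 1) + 1 = -n by ring, hneg, abs_sub_comm]
  have hs : Summable fun n : ℕ => |f ((n : ℤ) + 1) - f n| :=
    summable_of_sum_range_le (fun _ => abs_nonneg _) hpart
  have hs' : Summable fun n : ℕ => |f (-((n : ℤ) + 1) + 1) - f (-((n : ℤ) + 1))| := by
    simpa only [hrefl] using hs
  have hle := Real.tsum_le_of_sum_range_le (fun _ => abs_nonneg _) hpart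
  refine ⟨.of_nat_of_neg_add_one (f := fun k : ℤ => |f (k + 1) - f k|) hs hs', ?_⟩
  rw [tsum_of_nat_of_neg_add_one (f := fun k : ℤ => |f (k + 1) - f k|) hs hs']
  simp only [hrefl]
  linarith

/-- Total variation of the gradient of the discrete heat kernel on `ℤ`:
`Σ_{k∈ℤ} |∇p̄_t(k)| ≤ 2·p̄_t(0)`. -/
theorem heatKernelZ_grad_tv (c t : ℝ) (hc : 0 < c) (ht : 0 ≤ t) :
    Summable (fun k : ℤ => |heatKernelZ c t (k + 1) - heatKernelZ c t k|) ∧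
    ∑' k : ℤ, |heatKernelZ c t (k + 1) - heatKernelZ c t k| ≤ 2 * heatKernelZ c t 0 :=
  have h : 0 ≤ c * t := mul_nonneg hc.le ht
  summable_and_tsum_abs_sub_le_of_even (heatKernelZ_neg c t) (heatKernelZ_nonneg h)
    (heatKernelZ_antitone h)
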